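/- No one-way universal blind one-counter automaton (1U1BCA) over the alphabet {a,b} recognizes the complement of EQ* within {a,b}*; that is, there is no 1U1BCA whose set of accepted strings equals {w ∈ {a,b}* : w ∉ EQ*}. -/

import Mathlib

/-- Input symbols extended with the left (`cent`) and right (`dollar`) end-markers. -/
inductive TSym (α : Type) : Type
  | cent : TSym α
  | letter : α → TSym α
  | dollar : TSym α

/-- The tape content `¢ w $` for an input word `w`. -/
def tagged {α : Type} (w : List α) : List (TSym α) :=
  TSym.cent :: (w.map TSym.letter ++ [TSym.dollar])

/-- A one-way universal (nondeterministic, with universal acceptance) blind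
one-counter automaton. -/
structure OneU1BCA (α : Type) where
  Q : Type
  [fintypeQ : Fintype Q]
  q0 : Q
  acc : Set Q
  m : ℕ
  Δ : Q → TSym α → Q → ℤ → Prop
  bound : ∀ q σ q' c, Δ q σ q' c → |c| ≤ (m : ℤ)
  total : ∀ q σ, ∃ q' c, Δ q σ q' c

namespace OneU1BCA

variable {α : Type} (M : OneU1BCA α)

/-- The set of configurations reachable in one step from some configuration in `S`. -/
def stepU (S : Set (M.Q × ℤ)) (σ : TSym α) : Set (M.Q × ℤ) :=
  {p' | ∃ p ∈ S, ∃ c : ℤ, M.Δ p.1 σ p'.1 c ∧ p'.2 = p.2 + c}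

/-- The set of configurations reachable after reading `¢ w $`. -/
def reach (w : List α) : Set (M.Q × ℤ) :=
  (tagged w).foldl M.stepU {(M.q0, 0)}

/-- Universal acceptance: every computation path ends in an accepting state with
counter value exactly `0`. -/
def accepts (w : List α) : Prop :=
  ∀ p ∈ M.reach w, p.1 ∈ M.acc ∧ p.2 = 0

/-- `M` recognizes `L` if it accepts exactly the members of `L`. -/
def recognizes (L : Set (List α)) : Prop :=
  ∀ w : List α, M.accepts w ↔ w ∈ L

end OneU1BCA

/-- The alphabet `{a, b}`. -/
inductive Γ2 : Type
  | a : Γ2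
  | b : Γ2
deriving DecidableEq

/-- The language `EQ = { a^n b^n : n > 0 }`. -/
def EQ : Language Γ2 :=
  {w | ∃ n : ℕ, 0 < n ∧ w = List.replicate n Γ2.a ++ List.replicate n Γ2.b}

/-- The Kleene closure `EQ*`. -/
def EQstar : Language Γ2 := KStar.kstar EQ

namespace OneU1BCA

/-- `Run q l q' c`: some path from `q` to `q'` reading `l` changes the counter by `c`. -/
def Run {α : Type} (M : OneU1BCA α) : M.Q → List (TSym α) → M.Q → ℤ → Prop
  | q, [], q', c => q = q' ∧ c = 0
  | q, s :: l, q', c => ∃ r d, M.Δ q s r d ∧ Run M r l q' (c - d)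

theorem mem_foldl {α : Type} (M : OneU1BCA α) (l : List (TSym α)) (S : Set (M.Q × ℤ))
    (p' : M.Q × ℤ) :
    p' ∈ l.foldl M.stepU S ↔ ∃ p ∈ S, M.Run p.1 l p'.1 (p'.2 - p.2) := by
  induction l generalizing S with
  | nil =>
    simp only [List.foldl_nil, Run]
    constructor
    · intro h
      exact ⟨p', h, rfl, by simp⟩
    · rintro ⟨p, hp, h1, h2⟩
      have : p = p' := Prod.ext h1 (by linarith)
      exact this ▸ hp
  | cons s l ih =>
    simp only [List.foldl_cons, ih, Run]
    constructor
    · rintro ⟨r, ⟨p, hp, c, hc, e⟩, hr⟩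
      refine ⟨p, hp, r.1, c, hc, ?_⟩
      rw [e] at hr
      rwa [sub_sub]
    · rintro ⟨p, hp, r, d, hd, hr⟩
      refine ⟨(r, p.2 + d), ⟨p, hp, d, hd, rfl⟩, ?_⟩
      rwa [sub_sub] at hr

theorem run_append {α : Type} (M : OneU1BCA α) (l₁ l₂ : List (TSym α)) (q q' : M.Q) (c : ℤ) :
    M.Run q (l₁ ++ l₂) q' c ↔ ∃ r d, M.Run q l₁ r d ∧ M.Run r l₂ q' (c - d) := by
  induction l₁ generalizing q c with
  | nil =>
    simp only [List.nil_append, Run]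
    constructor
    · intro h
      exact ⟨q, 0, ⟨rfl, rfl⟩, by simpa using h⟩
    · rintro ⟨r, d, ⟨rfl, rfl⟩, h⟩
      simpa using h
  | cons s l ih =>
    simp only [List.cons_append, Run, ih]
    constructor
    · rintro ⟨r, d, h, r', d', h1, h2⟩
      refine ⟨r', d + d', ⟨r, d, h, by simpa using h1⟩, by rwa [← sub_sub]⟩
    · rintro ⟨r', d', ⟨r, d, h, h1⟩, h2⟩
      refine ⟨r, d, h, r', d' - d, h1, ?_⟩
      convert h2 using 1
      ring

theorem run_seq {α : Type} (M : OneU1BCA α) (s : TSym α) (n : ℕ) (q q' : M.Q) (c : ℤ)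
    (h : M.Run q (List.replicate n s) q' c) :
    ∃ f : ℕ → M.Q × ℤ, f 0 = (q, 0) ∧ f n = (q', c) ∧
      ∀ i < n, M.Δ (f i).1 s (f (i+1)).1 ((f (i+1)).2 - (f i).2) := by
  induction n generalizing q c with
  | zero =>
    obtain ⟨rfl, rfl⟩ := h
    exact ⟨fun _ => (q, 0), rfl, rfl, by simp⟩
  | succ n ih =>
    obtain ⟨r, d, hd, hr⟩ := h
    obtain ⟨g, g0, gn, hg⟩ := ih _ _ hr
    refine ⟨fun i => Nat.casesOn i (q, 0) (fun j => ((g j).1, (g j).2 + d)), rfl, ?_, ?_⟩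
    · simp [gn]
    · intro i hi
      cases i with
      | zero => simpa [g0] using hd
      | succ j => simpa using hg j (by omega)

theorem run_of_seq {α : Type} (M : OneU1BCA α) (s : TSym α) (n : ℕ) (f : ℕ → M.Q × ℤ)
    (hf : ∀ i < n, M.Δ (f i).1 s (f (i+1)).1 ((f (i+1)).2 - (f i).2)) (k i : ℕ)
    (h : i + k ≤ n) :
    M.Run (f i).1 (List.replicate k s) (f (i+k)).1 ((f (i+k)).2 - (f i).2) := by
  induction k generalizing i with
  | zero => simp [Run]
  | succ k ih =>
    refine ⟨_, _, hf i (by omega), ?_⟩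
    have := ih (i+1) (by omega)
    rw [show i + 1 + k = i + (k + 1) by omega] at this
    convert this using 1
    ring

theorem pump {α : Type} (M : OneU1BCA α) (s : TSym α) (n : ℕ) (q q' : M.Q) (c : ℤ)
    (hn : Nat.card M.Q ≤ n) (h : M.Run q (List.replicate n s) q' c) :
    ∃ l > 0, ∃ e : ℤ, ∀ k : ℕ, M.Run q (List.replicate (n + k * l) s) q' (c + k * e) := by
  haveI := M.fintypeQ
  obtain ⟨f, f0, fn, hf⟩ := M.run_seq s n q q' c h
  obtain ⟨x, y, hxy, he⟩ := Fintype.exists_ne_map_eq_of_card_lt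
    (fun i : Fin (n+1) => (f i).1) (by
      rw [Fintype.card_fin, ← Nat.card_eq_fintype_card]; omega)
  wlog hlt : x < y generalizing x y
  · exact this y x hxy.symm he.symm (lt_of_le_of_ne (not_lt.mp hlt) hxy.symm)
  obtain ⟨i, hi⟩ := x
  obtain ⟨j, hj⟩ := y
  simp only [Fin.mk_lt_mk] at hlt he
  obtain ⟨l, rfl⟩ := Nat.exists_eq_add_of_lt hlt
  rw [show i + l + 1 = i + (l+1) by ring] at *
  obtain ⟨t, rfl⟩ := Nat.exists_eq_add_of_le (Nat.lt_succ_iff.mp hj)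
  have h1 := M.run_of_seq s _ f hf i 0 (by omega)
  have h2 := M.run_of_seq s _ f hf (l+1) i (by omega)
  have h3 := M.run_of_seq s _ f hf t (i+(l+1)) (by omega)
  simp only [Nat.zero_add, f0, fn] at h1 h3
  rw [← he] at h2 h3
  refine ⟨l+1, by omega, (f (i+(l+1))).2 - (f i).2, fun k => ?_⟩
  have h4 : ∀ k : ℕ, M.Run (f i).1 (List.replicate (k * (l+1)) s) (f i).1
      (k * ((f (i+(l+1))).2 - (f i).2)) := by
    intro k
    induction k with
    | zero => simp [Run]
    | succ k ih =>
      rw [Nat.succ_mul, List.replicate_add, run_append]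
      refine ⟨_, _, ih, ?_⟩
      convert h2 using 1
      push_cast
      ring
  rw [show i + (l+1) + t + k * (l+1) = i + ((k+1) * (l+1) + t) by ring,
    List.replicate_add, List.replicate_add, run_append]
  refine ⟨_, _, h1, ?_⟩
  rw [run_append]
  refine ⟨_, _, h4 (k+1), ?_⟩
  convert h3 using 1
  push_cast
  ring

end OneU1BCA

theorem count_EQstar (w : List Γ2) (h : w ∈ EQstar) : w.count Γ2.a = w.count Γ2.b := by
  obtain ⟨L, rfl, hL⟩ := h
  induction L with
  | nil => simp
  | cons x L ih =>
    have h1 := ih (fun y hy => hL y (List.mem_cons_of_mem _ hy))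
    obtain ⟨n, -, rfl⟩ := hL x List.mem_cons_self
    simp [List.count_replicate, h1] 

/-- no 1U1BCA recognizes the complement of `EQ*` within `{a,b}*`. -/
theorem stmt14 : ¬ ∃ M : OneU1BCA Γ2, M.recognizes {w : List Γ2 | w ∉ EQstar} := by
  rintro ⟨M, hM⟩
  set n := Nat.card M.Q + 1 with hn
  have hin : List.replicate n Γ2.a ++ List.replicate n Γ2.b ∈ EQstar :=
    ⟨[List.replicate n Γ2.a ++ List.replicate n Γ2.b], by simp, by
      intro y hy
      rw [List.mem_singleton] at hy
      exact ⟨n, by omega, hy⟩⟩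
  refine (hM _).not.mpr (not_not.mpr hin) ?_
  have key : ∀ k (p : M.Q × ℤ),
      p ∈ M.reach (List.replicate k Γ2.a ++ List.replicate n Γ2.b) ↔
      M.Run M.q0 ([TSym.cent] ++ (List.replicate k (TSym.letter Γ2.a) ++
        (List.replicate n (TSym.letter Γ2.b) ++ [TSym.dollar]))) p.1 p.2 := by
    intro k p
    rw [OneU1BCA.reach, OneU1BCA.mem_foldl]
    simp [tagged]
  rintro ⟨q, v⟩ hp
  rw [key, OneU1BCA.run_append] at hp
  obtain ⟨r, d, h1, hp⟩ := hp
  rw [OneU1BCA.run_append] at hp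
  obtain ⟨r', d', h2, h3⟩ := hp
  obtain ⟨l, hl, e, hk⟩ := M.pump _ n _ _ _ (by omega) h2
  have good : ∀ k : ℕ, 0 < k → q ∈ M.acc ∧ v + k * e = 0 := by
    intro k hk0
    have hacc : M.accepts (List.replicate (n + k * l) Γ2.a ++ List.replicate n Γ2.b) := by
      rw [hM]
      intro hw
      have := count_EQstar _ hw
      simp [List.count_replicate] at this
      omega
    refine hacc (q, v + k * e) ?_
    rw [key, OneU1BCA.run_append]
    refine ⟨r, d, h1, ?_⟩
    rw [OneU1BCA.run_append]
    refine ⟨r', _, hk k, ?_⟩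
    convert h3 using 1
    ring
  have g1 := good 1 (by omega)
  have g2 := good 2 (by omega)
  refine ⟨g1.1, ?_⟩
  have e1 := g1.2
  have e2 := g2.2
  push_cast at e1 e2
  show v = 0
  linarith
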